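/- Let X_1, X_2, X_3 be independent uniform random points in a tetrahedron T of volume 1 and c the centroid of a facet of T. Then E[vol(conv{X_1,X_2,X_3,c})^6] = 347/28805414400. -/

import Mathlib

open MeasureTheory

/-- The corner simplex `{x ≥ 0, ∑ xᵢ ≤ a}` in `ℝⁿ`. -/
def cornerSimplex (n : ℕ) (a : ℝ) : Set (Fin n → ℝ) :=
  {x | (∀ i, 0 ≤ x i) ∧ ∑ i, x i ≤ a}

lemma isCompact_cornerSimplex (n : ℕ) (a : ℝ) : IsCompact (cornerSimplex n a) := by
  refine (isCompact_Icc (a := (0 : Fin n → ℝ)) (b := fun _ => a)).of_isClosed_subset ?_ ?_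
  · simp only [cornerSimplex, Set.ofPred_and, Set.ofPred_forall]
    exact (isClosed_iInter fun i => isClosed_le continuous_const (continuous_apply i)).inter
      (isClosed_le (by fun_prop) continuous_const)
  · rintro x ⟨h0, h1⟩
    exact ⟨h0, fun i =>
      (Finset.single_le_sum (fun j _ => h0 j) (Finset.mem_univ i)).trans h1⟩

lemma convex_cornerSimplex (n : ℕ) (a : ℝ) : Convex ℝ (cornerSimplex n a) := by
  rintro x ⟨hx0, hx1⟩ y ⟨hy0, hy1⟩ s t hs ht hst
  refine ⟨fun i => ?_, ?_⟩
  · have := hx0 i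
    have := hy0 i
    simp only [Pi.add_apply, Pi.smul_apply, smul_eq_mul]
    positivity
  · simp only [Pi.add_apply, Pi.smul_apply, smul_eq_mul, Finset.sum_add_distrib,
      ← Finset.mul_sum]
    calc s * ∑ i, x i + t * ∑ i, y i ≤ s * a + t * a := by gcongr
      _ = a := by rw [← add_mul, hst, one_mul]

lemma cons_mem_cornerSimplex {n : ℕ} {a x : ℝ} {y : Fin n → ℝ} :
    (Fin.cons x y : Fin (n + 1) → ℝ) ∈ cornerSimplex (n + 1) a ↔
      0 ≤ x ∧ y ∈ cornerSimplex n (a - x) := by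
  simp only [cornerSimplex, Set.mem_ofPred_eq, Fin.forall_fin_succ, Fin.sum_univ_succ,
    Fin.cons_zero, Fin.cons_succ, and_assoc, le_sub_iff_add_le']

lemma integral_cornerSimplex_succ {n : ℕ} {a : ℝ} (ha : 0 ≤ a) {f : (Fin (n + 1) → ℝ) → ℝ}
    (hf : Continuous f) :
    ∫ x in cornerSimplex (n + 1) a, f x =
      ∫ x in (0 : ℝ)..a, ∫ y in cornerSimplex n (a - x), f (Fin.cons x y) := by
  have hmeas : ∀ m b, MeasurableSet (cornerSimplex m b) := fun m b =>
    (isCompact_cornerSimplex m b).measurableSet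
  have hint : Integrable ((cornerSimplex (n + 1) a).indicator f) :=
    (integrable_indicator_iff (hmeas _ _)).2
      (hf.continuousOn.integrableOn_compact (isCompact_cornerSimplex _ _))
  have hpres := (volume_preserving_piFinSuccAbove (fun _ : Fin (n + 1) => ℝ) 0).symm
  have hcons : ∀ p : ℝ × (Fin n → ℝ),
      (MeasurableEquiv.piFinSuccAbove (fun _ : Fin (n + 1) => ℝ) 0).symm p =
        Fin.cons p.1 p.2 := fun p => by
    simp [MeasurableEquiv.piFinSuccAbove, Fin.insertNthEquiv]
  rw [← integral_indicator (hmeas _ _), ← hpres.integral_comp', Measure.volume_eq_prod,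
    integral_prod, intervalIntegral.integral_of_le ha, ← integral_Icc_eq_integral_Ioc,
    ← integral_indicator measurableSet_Icc]
  · congr 1
    ext x
    by_cases hx : x ∈ Set.Icc 0 a
    · rw [Set.indicator_of_mem hx, ← integral_indicator (hmeas _ _)]
      congr 1
      ext y
      rw [hcons]
      by_cases hy : y ∈ cornerSimplex n (a - x)
      · rw [Set.indicator_of_mem hy, Set.indicator_of_mem (cons_mem_cornerSimplex.2 ⟨hx.1, hy⟩)]
      · rw [Set.indicator_of_notMem hy,
          Set.indicator_of_notMem fun h => hy (cons_mem_cornerSimplex.1 h).2]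
    · rw [Set.indicator_of_notMem hx]
      refine integral_eq_zero_of_ae (.of_forall fun y => Set.indicator_of_notMem (fun h => ?_) _)
      rw [hcons, cons_mem_cornerSimplex] at h
      have := (Finset.sum_nonneg fun i _ => h.2.1 i).trans h.2.2
      exact hx ⟨h.1, by linarith⟩
  · have := (hpres.integrable_comp_emb (MeasurableEquiv.measurableEmbedding _)).2 hint
    rwa [Measure.volume_eq_prod] at this

lemma integral_pow_mul_sub_pow (a : ℝ) (m n : ℕ) :
    ∫ x in (0 : ℝ)..a, x ^ m * (a - x) ^ n =
      a ^ (m + n + 1) * (m.factorial * n.factorial / (m + n + 1).factorial) := by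
  induction n generalizing m with
  | zero =>
    simp only [pow_zero, mul_one, integral_pow, Nat.factorial_succ, add_zero]
    push_cast
    field_simp
    simp
  | succ n ih =>
    have hderiv : ∀ x ∈ Set.uIcc 0 a, HasDerivAt (fun x => x ^ (m + 1) * (a - x) ^ (n + 1))
        ((m + 1) * (x ^ m * (a - x) ^ (n + 1)) - (n + 1) * (x ^ (m + 1) * (a - x) ^ n)) x := by
      intro x _
      convert! ((hasDerivAt_id x).pow (m + 1)).mul
        (((hasDerivAt_id x).const_sub a).pow (n + 1)) using 1
      simp
      ring
    have hparts := intervalIntegral.integral_eq_sub_of_hasDerivAt hderiv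
      (Continuous.intervalIntegrable (by fun_prop) _ _)
    rw [intervalIntegral.integral_sub (Continuous.intervalIntegrable (by fun_prop) _ _)
      (Continuous.intervalIntegrable (by fun_prop) _ _),
      intervalIntegral.integral_const_mul, intervalIntegral.integral_const_mul, ih] at hparts
    have hm : (m + 1 : ℝ) ≠ 0 := by positivity
    apply mul_left_cancel₀ hm
    simp only [sub_self, ne_eq, Nat.add_eq_zero_iff, one_ne_zero, and_false, not_false_eq_true,
      zero_pow, mul_zero, zero_mul, sub_eq_zero] at hparts
    rw [hparts, show m + (n + 1) + 1 = m + 1 + n + 1 by ring, Nat.factorial_succ m,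
      Nat.factorial_succ n]
    push_cast
    ring

lemma integral_cornerSimplex_prod_pow (n : ℕ) {a : ℝ} (ha : 0 ≤ a) (e : Fin n → ℕ) :
    ∫ x in cornerSimplex n a, ∏ i, x i ^ e i =
      a ^ (n + ∑ i, e i) * ((∏ i, ((e i).factorial : ℝ)) / (n + ∑ i, e i).factorial) := by
  induction n generalizing a with
  | zero =>
    have : cornerSimplex 0 a = Set.univ := by ext x; simp [cornerSimplex, ha]
    simp [this, measureReal_def, volume_pi]
  | succ n ih =>
    rw [integral_cornerSimplex_succ ha (by fun_prop)]
    have hinner : ∀ x ∈ Set.uIcc 0 a, ∫ y in cornerSimplex n (a - x),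
        ∏ i, (Fin.cons x y : Fin (n + 1) → ℝ) i ^ e i =
        (x ^ e 0 * (a - x) ^ (n + ∑ i : Fin n, e i.succ)) *
          ((∏ i : Fin n, ((e i.succ).factorial : ℝ)) /
            (n + ∑ i : Fin n, e i.succ).factorial) := by
      intro x hx
      rw [Set.uIcc_of_le ha] at hx
      simp only [Fin.prod_univ_succ, Fin.cons_zero, Fin.cons_succ, integral_const_mul]
      rw [ih (sub_nonneg.2 hx.2), mul_assoc]
    rw [intervalIntegral.integral_congr hinner, intervalIntegral.integral_mul_const,
      integral_pow_mul_sub_pow, Fin.sum_univ_succ, Fin.prod_univ_succ,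
      show n + 1 + (e 0 + ∑ i : Fin n, e i.succ) = e 0 + (n + ∑ i : Fin n, e i.succ) + 1 by ring]
    have : ((n + ∑ i : Fin n, e i.succ).factorial : ℝ) ≠ 0 := by positivity
    field_simp

lemma volume_cornerSimplex_three : volume (cornerSimplex 3 1) = ENNReal.ofReal (1 / 6) := by
  have h := integral_cornerSimplex_prod_pow 3 zero_le_one 0
  have hfin := (isCompact_cornerSimplex 3 1).measure_ne_top (μ := volume)
  simp only [Pi.zero_apply, pow_zero, Finset.prod_const_one, integral_const, smul_eq_mul,
    mul_one, measureReal_restrict_apply_univ] at h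
  rw [← ENNReal.ofReal_toReal hfin, ← measureReal_def, h]
  norm_num [Nat.factorial]

/-- The matrix whose columns are the edge vectors `q j - p`. -/
def edgeMatrix {n : ℕ} (p : Fin n → ℝ) (q : Fin n → Fin n → ℝ) : Matrix (Fin n) (Fin n) ℝ :=
  .of fun i j => q j i - p i

lemma edgeMatrix_mulVec {n : ℕ} (p : Fin n → ℝ) (q : Fin n → Fin n → ℝ) (y : Fin n → ℝ) :
    (edgeMatrix p q).mulVec y = ∑ j, y j • (q j - p) := by
  ext i
  simp [Matrix.mulVec, dotProduct, edgeMatrix, mul_comm]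

lemma convexHull_insert_range_eq {n : ℕ} (p : Fin n → ℝ) (q : Fin n → Fin n → ℝ) :
    convexHull ℝ (insert p (Set.range q)) =
      (fun y => p + (edgeMatrix p q).mulVec y) '' cornerSimplex n 1 := by
  apply Set.Subset.antisymm
  · apply convexHull_min
    · rintro x (rfl | ⟨j, rfl⟩)
      · exact ⟨0, ⟨by simp, by simp⟩, by simp⟩
      · refine ⟨Pi.single j 1, ⟨fun i => ?_, by simp⟩, ?_⟩
        · by_cases h : i = j
          · subst h; simp
          · simp [h]
        · ext i
          simp [edgeMatrix]
    · have := ((convex_cornerSimplex n 1).is_linear_image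
        (Matrix.mulVecLin (edgeMatrix p q)).isLinear).vadd p
      rwa [← Set.image_vadd, Set.image_image] at this
  · rintro _ ⟨y, ⟨h0, h1⟩, rfl⟩
    have hmem := (convex_convexHull ℝ (insert p (Set.range q))).sum_mem
      (t := Finset.univ) (w := (Fin.cons (1 - ∑ i, y i) y : Fin (n + 1) → ℝ))
      (z := (Fin.cons p q : Fin (n + 1) → Fin n → ℝ)) ?_ ?_ ?_
    · convert! hmem using 1
      simp only [edgeMatrix_mulVec, Fin.sum_univ_succ, Fin.cons_zero, Fin.cons_succ, smul_sub,
        Finset.sum_sub_distrib, ← Finset.sum_smul, sub_smul, one_smul]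
      abel
    · intro i _
      refine Fin.cases ?_ (fun j => ?_) i
      · simpa using h1
      · simpa using h0 j
    · simp [Fin.sum_univ_succ]
    · intro i _
      apply subset_convexHull
      refine Fin.cases ?_ (fun j => ?_) i
      · simp
      · simp

lemma volume_convexHull_insert_range (p : Fin 3 → ℝ) (q : Fin 3 → Fin 3 → ℝ) :
    volume (convexHull ℝ (insert p (Set.range q))) =
      ENNReal.ofReal (|(edgeMatrix p q).det| / 6) := by
  have h : (fun y => p + (edgeMatrix p q).mulVec y) '' cornerSimplex 3 1 =
      (fun z => p + z) '' (Matrix.toLin' (edgeMatrix p q) '' cornerSimplex 3 1) := by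
    rw [Set.image_image]
    rfl
  rw [convexHull_insert_range_eq, h, Set.image_add_left, measure_preimage_add,
    Measure.addHaar_image_linearMap, LinearMap.det_toLin', volume_cornerSimplex_three,
    ← ENNReal.ofReal_mul (abs_nonneg _)]
  ring_nf

lemma setIntegral_convexHull_insert_range {p : Fin 3 → ℝ} {q : Fin 3 → Fin 3 → ℝ}
    (hdet : |(edgeMatrix p q).det| = 6) (f : (Fin 3 → ℝ) → ℝ) :
    ∫ x in convexHull ℝ (insert p (Set.range q)), f x =
      6 * ∫ y in cornerSimplex 3 1, f (p + (edgeMatrix p q).mulVec y) := by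
  have hunit : IsUnit (edgeMatrix p q) := by
    rw [Matrix.isUnit_iff_isUnit_det, isUnit_iff_ne_zero, ← abs_pos, hdet]
    norm_num
  have hderiv : ∀ y ∈ cornerSimplex 3 1, HasFDerivWithinAt
      (fun y => p + (edgeMatrix p q).mulVec y)
      (LinearMap.toContinuousLinearMap (Matrix.toLin' (edgeMatrix p q)))
      (cornerSimplex 3 1) y := fun y _ =>
    ((LinearMap.toContinuousLinearMap
      (Matrix.toLin' (edgeMatrix p q))).hasFDerivAt.const_add p).hasFDerivWithinAt
  rw [convexHull_insert_range_eq, integral_image_eq_integral_abs_det_fderiv_smul volume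
    (isCompact_cornerSimplex 3 1).measurableSet hderiv
    (((add_right_injective p).comp (Matrix.mulVec_injective_of_isUnit hunit)).injOn)]
  simp only [LinearMap.det_toContinuousLinearMap, LinearMap.det_toLin', hdet, smul_eq_mul,
    integral_const_mul]

lemma edgeMatrix_affine {n : ℕ} (p o : Fin n → ℝ) (A : Matrix (Fin n) (Fin n) ℝ)
    (q : Fin n → Fin n → ℝ) :
    edgeMatrix (o + A.mulVec p) (fun j => o + A.mulVec (q j)) = A * edgeMatrix p q := by
  ext i j
  simp [edgeMatrix, Matrix.mul_apply, Matrix.mulVec, dotProduct, mul_sub]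

/-- The sum `∑ k < n, f k` by primitive recursion, which the kernel evaluates quickly. -/
def sumBelow (n : ℕ) (f : ℕ → ℤ) : ℤ :=
  n.rec 0 fun k s => s + f k

lemma sumBelow_eq_sum_range (n : ℕ) (f : ℕ → ℤ) : sumBelow n f = ∑ k ∈ Finset.range n, f k := by
  induction n with
  | zero => rfl
  | succ n ih => rw [Finset.sum_range_succ, ← ih]; rfl

/-- The value `f n`, arranged so that the kernel evaluates `n` before it unfolds `f`. -/
def evalThen (n : ℕ) (f : ℕ → ℤ) : ℤ :=
  n.rec (f 0) fun k _ => f (k + 1)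

lemma evalThen_eq (n : ℕ) (f : ℕ → ℤ) : evalThen n f = f n := by
  cases n <;> rfl

/-- The integral of `(y₀ - 1/3)ⁱ (y₁ - 1/3)ʲ y₂ᵏ` over the corner simplex in `ℝ³`, multiplied by
`3 ^ (i + j + k) * (i + j + k + 3)!`. -/
def scaledMoment (i j k : ℕ) : ℤ :=
  evalThen i fun i => evalThen j fun j => evalThen k fun k =>
  sumBelow (i + 1) fun p => sumBelow (j + 1) fun q =>
    (-1) ^ (i - p + (j - q)) *
      (i.choose p * j.choose q * (p.factorial * q.factorial * k.factorial) * 3 ^ (p + q + k) *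
        (3 + (p + q + k) + 1).ascFactorial (i - p + (j - q)) : ℕ)

/-- The coefficients in the expansion of the `n`-th power of a `3 × 3` determinant. -/
def detCoeff (n p q i j l : ℕ) : ℤ :=
  (-1) ^ (p - i + (q - j) + (n - p - q - l)) *
    (n.choose p * (n - p).choose q * (p.choose i * q.choose j * (n - p - q).choose l) : ℕ)

/-- The sum of the scaled moments of all monomials of the `n`-th power of a `3 × 3` determinant. -/
def scaledDetMoment (n : ℕ) : ℤ :=
  sumBelow (n + 1) fun p => sumBelow (n - p + 1) fun q =>
    sumBelow (p + 1) fun i => sumBelow (q + 1) fun j => sumBelow (n - p - q + 1) fun l =>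
      detCoeff n p q i j l *
        scaledMoment (q - j + l) (i + (n - p - q - l)) (p - i + j) *
        scaledMoment (j + (n - p - q - l)) (p - i + l) (i + (q - j)) *
        scaledMoment p q (n - p - q)

lemma integral_shiftedMonomial (i j k : ℕ) :
    ∫ y in cornerSimplex 3 1, (y 0 - 1 / 3) ^ i * (y 1 - 1 / 3) ^ j * y 2 ^ k =
      (scaledMoment i j k : ℝ) / (3 ^ (i + j + k) * (i + j + k + 3).factorial) := by
  have hexpand : ∀ y : Fin 3 → ℝ, (y 0 - 1 / 3) ^ i * (y 1 - 1 / 3) ^ j * y 2 ^ k =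
      ∑ p ∈ Finset.range (i + 1), ∑ q ∈ Finset.range (j + 1),
        (-1 / 3) ^ (i - p) * (i.choose p) * ((-1 / 3) ^ (j - q) * (j.choose q)) *
          ∏ l, y l ^ (![p, q, k] l) := by
    intro y
    rw [show y 0 - 1 / 3 = y 0 + (-1 / 3) by ring, show y 1 - 1 / 3 = y 1 + (-1 / 3) by ring,
      add_pow, add_pow, Finset.sum_mul_sum, Finset.sum_mul]
    refine Finset.sum_congr rfl fun p _ => ?_
    rw [Finset.sum_mul]
    refine Finset.sum_congr rfl fun q _ => ?_
    simp only [Fin.prod_univ_three, Matrix.cons_val]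
    ring
  have hint : ∀ (c : ℝ) (e : Fin 3 → ℕ),
      IntegrableOn (fun y : Fin 3 → ℝ => c * ∏ l, y l ^ e l) (cornerSimplex 3 1) := fun c e =>
    ContinuousOn.integrableOn_compact (isCompact_cornerSimplex 3 1) (by fun_prop)
  simp only [hexpand, scaledMoment, evalThen_eq, sumBelow_eq_sum_range]
  rw [integral_finsetSum _ fun p _ => integrable_finsetSum _ fun q _ => hint _ _]
  push_cast
  rw [Finset.sum_div]
  refine Finset.sum_congr rfl fun p hp => ?_
  rw [integral_finsetSum _ fun q _ => hint _ _, Finset.sum_div]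
  refine Finset.sum_congr rfl fun q hq => ?_
  rw [integral_const_mul, integral_cornerSimplex_prod_pow 3 zero_le_one]
  simp only [Fin.prod_univ_three, Fin.sum_univ_three, Matrix.cons_val, one_pow, one_mul]
  obtain ⟨s, rfl⟩ := Nat.exists_eq_add_of_le (Finset.mem_range_succ_iff.1 hp)
  obtain ⟨t, rfl⟩ := Nat.exists_eq_add_of_le (Finset.mem_range_succ_iff.1 hq)
  rw [Nat.add_sub_cancel_left, Nat.add_sub_cancel_left,
    show p + s + (q + t) + k + 3 = 3 + (p + q + k) + (s + t) by ring,
    ← Nat.factorial_mul_ascFactorial (3 + (p + q + k)) (s + t)]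
  have hfac : ((3 + (p + q + k)).factorial : ℝ) ≠ 0 := by positivity
  have hasc : ((3 + (p + q + k) + 1).ascFactorial (s + t) : ℝ) ≠ 0 := by
    exact_mod_cast (Nat.ascFactorial_pos _ _).ne'
  push_cast
  rw [div_pow, div_pow]
  field_simp
  ring

lemma det_fin_three_pow (a b c : Fin 3 → ℝ) (n : ℕ) :
    (Matrix.of fun i j => ![a, b, c] j i).det ^ n =
      ∑ p ∈ Finset.range (n + 1), ∑ q ∈ Finset.range (n - p + 1),
      ∑ i ∈ Finset.range (p + 1), ∑ j ∈ Finset.range (q + 1),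
      ∑ l ∈ Finset.range (n - p - q + 1),
        (detCoeff n p q i j l : ℝ) *
          (a 0 ^ (q - j + l) * a 1 ^ (i + (n - p - q - l)) * a 2 ^ (p - i + j)) *
          (b 0 ^ (j + (n - p - q - l)) * b 1 ^ (p - i + l) * b 2 ^ (i + (q - j))) *
          (c 0 ^ p * c 1 ^ q * c 2 ^ (n - p - q)) := by
  have hdet : (Matrix.of fun i j => ![a, b, c] j i).det =
      c 0 * (a 1 * b 2 + -(a 2 * b 1)) + (c 1 * (a 2 * b 0 + -(a 0 * b 2)) +
        c 2 * (a 0 * b 1 + -(a 1 * b 0))) := by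
    simp [Matrix.det_fin_three]
    ring
  rw [hdet, add_pow]
  refine Finset.sum_congr rfl fun p _ => ?_
  rw [add_pow, Finset.mul_sum, Finset.sum_mul]
  refine Finset.sum_congr rfl fun q _ => ?_
  rw [mul_pow (c 0), add_pow (a 1 * b 2)]
  simp only [Finset.mul_sum, Finset.sum_mul]
  refine Finset.sum_congr rfl fun i _ => ?_
  rw [mul_pow (c 1), add_pow (a 2 * b 0)]
  simp only [Finset.mul_sum, Finset.sum_mul]
  refine Finset.sum_congr rfl fun j _ => ?_
  rw [mul_pow (c 2), add_pow (a 0 * b 1)]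
  simp only [Finset.mul_sum, Finset.sum_mul, detCoeff]
  refine Finset.sum_congr rfl fun l _ => ?_
  rw [neg_pow (a 2 * b 1), neg_pow (a 0 * b 2), neg_pow (a 1 * b 0)]
  push_cast
  ring

/-- `F` has iterated integral `I`, and all partial integrals converge. -/
def HasIteratedIntegral {α : Type*} [MeasurableSpace α] (μ : Measure α) (F : α → α → α → ℝ)
    (I : ℝ) : Prop :=
  (∀ x y, Integrable (F x y) μ) ∧ (∀ x, Integrable (fun y => ∫ z, F x y z ∂μ) μ) ∧
    Integrable (fun x => ∫ y, ∫ z, F x y z ∂μ ∂μ) μ ∧ ∫ x, ∫ y, ∫ z, F x y z ∂μ ∂μ ∂μ = I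

lemma HasIteratedIntegral.sum {α ι : Type*} [MeasurableSpace α] {μ : Measure α} {s : Finset ι}
    {F : ι → α → α → α → ℝ} {I : ι → ℝ} (h : ∀ i ∈ s, HasIteratedIntegral μ (F i) (I i)) :
    HasIteratedIntegral μ (fun x y z => ∑ i ∈ s, F i x y z) (∑ i ∈ s, I i) := by
  have hz : ∀ x y, ∫ z, ∑ i ∈ s, F i x y z ∂μ = ∑ i ∈ s, ∫ z, F i x y z ∂μ := fun x y =>
    integral_finsetSum s fun i hi => (h i hi).1 x y
  have hy : ∀ x, ∫ y, ∑ i ∈ s, ∫ z, F i x y z ∂μ ∂μ = ∑ i ∈ s, ∫ y, ∫ z, F i x y z ∂μ ∂μ :=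
    fun x => integral_finsetSum s fun i hi => (h i hi).2.1 x
  refine ⟨fun x y => integrable_finsetSum s fun i hi => (h i hi).1 x y, fun x => ?_, ?_, ?_⟩
  · simp only [hz]
    exact integrable_finsetSum s fun i hi => (h i hi).2.1 x
  · simp only [hz, hy]
    exact integrable_finsetSum s fun i hi => (h i hi).2.2.1
  · simp only [hz, hy]
    rw [integral_finsetSum s fun i hi => (h i hi).2.2.1]
    exact Finset.sum_congr rfl fun i hi => (h i hi).2.2.2

lemma HasIteratedIntegral.mul {α : Type*} [MeasurableSpace α] {μ : Measure α} (w : ℝ)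
    {f g h : α → ℝ} (hf : Integrable f μ) (hg : Integrable g μ) (hh : Integrable h μ) :
    HasIteratedIntegral μ (fun x y z => w * f x * g y * h z)
      (w * (∫ x, f x ∂μ) * (∫ y, g y ∂μ) * ∫ z, h z ∂μ) := by
  refine ⟨fun x y => hh.const_mul _, fun x => ?_, ?_, ?_⟩
  all_goals simp only [integral_const_mul, integral_mul_const]
  · exact (hg.const_mul _).mul_const _
  · exact ((hf.const_mul _).mul_const _).mul_const _

lemma integral_det_pow (n : ℕ) :
    ∫ y₁ in cornerSimplex 3 1, ∫ y₂ in cornerSimplex 3 1, ∫ y₃ in cornerSimplex 3 1,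
      (edgeMatrix ![1 / 3, 1 / 3, 0] ![y₁, y₂, y₃]).det ^ n =
      (scaledDetMoment n : ℝ) / (3 ^ n * (n + 3).factorial) ^ 3 := by
  have hmat : ∀ y₁ y₂ y₃ : Fin 3 → ℝ, edgeMatrix ![1 / 3, 1 / 3, 0] ![y₁, y₂, y₃] =
      Matrix.of fun i j => ![![y₁ 0 - 1 / 3, y₁ 1 - 1 / 3, y₁ 2],
        ![y₂ 0 - 1 / 3, y₂ 1 - 1 / 3, y₂ 2], ![y₃ 0 - 1 / 3, y₃ 1 - 1 / 3, y₃ 2]] j i := by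
    intro y₁ y₂ y₃
    ext i j
    fin_cases i <;> fin_cases j <;> simp [edgeMatrix]
  have hint : ∀ i j k : ℕ, Integrable
      (fun y : Fin 3 → ℝ => (y 0 - 1 / 3) ^ i * (y 1 - 1 / 3) ^ j * y 2 ^ k)
      (volume.restrict (cornerSimplex 3 1)) := fun i j k =>
    ContinuousOn.integrableOn_compact (isCompact_cornerSimplex 3 1) (by fun_prop)
  have hsum := HasIteratedIntegral.sum (s := Finset.range (n + 1)) fun p _ =>
    HasIteratedIntegral.sum (s := Finset.range (n - p + 1)) fun q _ =>
    HasIteratedIntegral.sum (s := Finset.range (p + 1)) fun i _ =>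
    HasIteratedIntegral.sum (s := Finset.range (q + 1)) fun j _ =>
    HasIteratedIntegral.sum (s := Finset.range (n - p - q + 1)) fun l _ =>
    HasIteratedIntegral.mul (detCoeff n p q i j l : ℝ)
      (hint (q - j + l) (i + (n - p - q - l)) (p - i + j))
      (hint (j + (n - p - q - l)) (p - i + l) (i + (q - j))) (hint p q (n - p - q))
  simp only [hmat, det_fin_three_pow, Matrix.cons_val]
  rw [hsum.2.2.2]
  simp only [scaledDetMoment, sumBelow_eq_sum_range, Int.cast_sum, Finset.sum_div]
  refine Finset.sum_congr rfl fun p hp => Finset.sum_congr rfl fun q hq =>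
    Finset.sum_congr rfl fun i hi => Finset.sum_congr rfl fun j hj =>
    Finset.sum_congr rfl fun l hl => ?_
  rw [Finset.mem_range] at hp hq hi hj hl
  simp only [integral_shiftedMonomial]
  rw [show q - j + l + (i + (n - p - q - l)) + (p - i + j) = n by lia,
    show j + (n - p - q - l) + (p - i + l) + (i + (q - j)) = n by lia,
    show p + q + (n - p - q) = n by lia]
  push_cast
  field_simp

lemma scaledDetMoment_six :
    scaledDetMoment 6 * (216 * 28805414400) = 347 * (3 ^ 6 * Nat.factorial 9) ^ 3 := by
  decide +kernel

theorem moment_6 (v : Fin 4 → (Fin 3 → ℝ))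
    (hv : AffineIndependent ℝ v) (T : Set (Fin 3 → ℝ))
    (hT : T = convexHull ℝ (Set.range v)) (hvol : volume T = 1)
    (c : Fin 3 → ℝ) (hc : c = (3:ℝ)⁻¹ • (v 0 + v 1 + v 2)) :
    (∫ x₁ in T, ∫ x₂ in T, ∫ x₃ in T,
        (volume (convexHull ℝ ({x₁, x₂, x₃, c} : Set (Fin 3 → ℝ)))).toReal ^ 6)
      = 347 / 28805414400 := by
  have hrange : Set.range v = insert (v 0) (Set.range fun j : Fin 3 => v j.succ) := by
    rw [← Fin.cons_self_tail v, Fin.range_cons]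
    rfl
  rw [hrange] at hT
  set A := edgeMatrix (v 0) fun j : Fin 3 => v j.succ with hA
  have hdet : |A.det| = 6 := by
    rw [hT, volume_convexHull_insert_range, ENNReal.ofReal_eq_one] at hvol
    linarith
  have hc' : c = v 0 + A.mulVec ![1 / 3, 1 / 3, 0] := by
    rw [hc, hA, edgeMatrix_mulVec]
    ext i
    simp [Fin.sum_univ_three]
    ring
  have hvolume : ∀ y₁ y₂ y₃ : Fin 3 → ℝ,
      (volume (convexHull ℝ ({v 0 + A.mulVec y₁, v 0 + A.mulVec y₂, v 0 + A.mulVec y₃, c} :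
        Set (Fin 3 → ℝ)))).toReal ^ 6 =
        (edgeMatrix ![1 / 3, 1 / 3, 0] ![y₁, y₂, y₃]).det ^ 6 := by
    intro y₁ y₂ y₃
    have hset : ({v 0 + A.mulVec y₁, v 0 + A.mulVec y₂, v 0 + A.mulVec y₃, c} :
        Set (Fin 3 → ℝ)) = insert c (Set.range fun j => v 0 + A.mulVec (![y₁, y₂, y₃] j)) := by
      ext x
      simp only [Set.mem_insert_iff, Set.mem_singleton_iff, Set.mem_range, Fin.exists_fin_succ,
        Matrix.cons_val_zero, Matrix.cons_val_succ]
      simp [eq_comm]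
      tauto
    rw [hset, hc', volume_convexHull_insert_range, edgeMatrix_affine, Matrix.det_mul, abs_mul,
      hdet, ENNReal.toReal_ofReal (by positivity), mul_div_cancel_left₀ _ (by norm_num),
      Even.pow_abs (by decide)]
  simp only [hT, setIntegral_convexHull_insert_range hdet, ← hA, hvolume, integral_const_mul,
    integral_det_pow]
  have hsix := congrArg (Int.cast : ℤ → ℝ) scaledDetMoment_six
  push_cast at hsix
  rw [← mul_assoc, ← mul_assoc, mul_div_assoc', div_eq_div_iff (by positivity) (by norm_num)]
  linarith
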